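/- Fix d ≥ 2 and let m = 8(⌈d · log₂ d⌉ + 1). Then no sequence of m pairs (u^1, v^1), …, (u^m, v^m) of vectors in ℝ^d with strictly positive entries is shattered by the comparison class C_d = {(u, v) ↦ C((u, v); w, p) : w ∈ Δ_{d−1}, p ∈ ℝ}: there exists a sign pattern b ∈ {−1, +1}^m such that no (w, p) ∈ Δ_{d−1} × ℝ satisfies C((u^j, v^j); w, p) = b_j for all j = 1, …, m. Consequently the VC dimension of C_d is strictly less than 8(d log₂ d + 1). -/

import Mathlib

/-- The weighted power mean `M(u; w, p)`. -/
noncomputable def pmean {d : ℕ} (u w : Fin d → ℝ) (p : ℝ) : ℝ :=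
  if p = 0 then ∏ i, u i ^ w i else (∑ i, w i * u i ^ p) ^ (1 / p)

/-- `w` belongs to the probability simplex `Δ_{d-1}`. -/
def inSimplex {d : ℕ} (w : Fin d → ℝ) : Prop :=
  (∀ i, 0 ≤ w i) ∧ ∑ i, w i = 1

/-- The sign function: `+1` if `t ≥ 0`, `-1` if `t < 0`. -/
noncomputable def sgn (t : ℝ) : ℝ := if 0 ≤ t then 1 else -1

/-- The comparison function `C((u,v); w, p) = sign(log M(u;w,p) - log M(v;w,p))`. -/
noncomputable def pcmp {d : ℕ} (u v w : Fin d → ℝ) (p : ℝ) : ℝ :=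
  sgn (Real.log (pmean u w p) - Real.log (pmean v w p))


open Finset
theorem expsum_zeros {κ : Type*} [DecidableEq κ] (S : Finset κ) : ∀ (c l : κ → ℝ),
    (∃ p : ℝ, ∑ k ∈ S, c k * Real.exp (l k * p) ≠ 0) →
    ∃ Z : Finset ℝ, Z.card + 1 ≤ S.card ∧ ∀ p : ℝ, ∑ k ∈ S, c k * Real.exp (l k * p) = 0 → p ∈ Z := by
  induction S using Finset.induction_on with
  | empty => intro c l ⟨p, hp⟩; simp at hp
  | insert a S ha ih =>
    intro c l ⟨p0, hp0⟩
    let g : ℝ → ℝ := fun p => c a + ∑ k ∈ S, c k * Real.exp ((l k - l a) * p)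
    have hg : ∀ p, ∑ k ∈ insert a S, c k * Real.exp (l k * p) = Real.exp (l a * p) * g p := by
      intro p
      simp only [g]
      rw [Finset.sum_insert ha, mul_add, Finset.mul_sum]
      congr 1
      · ring
      · refine Finset.sum_congr rfl fun k _ => ?_
        rw [mul_left_comm, ← Real.exp_add]; ring_nf
    have hz : ∀ p, ∑ k ∈ insert a S, c k * Real.exp (l k * p) = 0 ↔ g p = 0 := by
      intro p; rw [hg]; simp [Real.exp_ne_zero]
    have hd : ∀ p, HasDerivAt g (∑ k ∈ S, (c k * (l k - l a)) * Real.exp ((l k - l a) * p)) p := by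
      intro p
      refine HasDerivAt.const_add _ ?_
      refine HasDerivAt.fun_sum fun k _ => ?_
      have : HasDerivAt (fun q => c k * Real.exp ((l k - l a) * q))
          (c k * (Real.exp ((l k - l a) * p) * ((l k - l a) * 1))) p :=
        (((hasDerivAt_id p).const_mul (l k - l a)).exp).const_mul (c k)
      exact this.congr_deriv (by ring)
    have hg0 : g p0 ≠ 0 := fun h => hp0 ((hz p0).2 h)
    by_cases hne : ∃ p : ℝ, ∑ k ∈ S, (c k * (l k - l a)) * Real.exp ((l k - l a) * p) ≠ 0
    · obtain ⟨Z, hZc, hZ⟩ := ih _ _ hne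
      have key : ∀ W : Finset ℝ, (∀ p ∈ W, g p = 0) → W.card ≤ Z.card + 1 := by
        intro W hW
        refine Finset.card_le_of_interleaved fun x hx y hy hxy _ => ?_
        obtain ⟨z, hz1, hz2⟩ := exists_hasDerivAt_eq_zero (f := g) hxy
          (fun q _ => (hd q).continuousAt.continuousWithinAt) ((hW x hx).trans (hW y hy).symm)
          (fun q _ => hd q)
        exact ⟨z, hZ z hz2, hz1.1, hz1.2⟩
      have hfin : {p | g p = 0}.Finite := by
        by_contra hinf
        obtain ⟨W, hW, hWc⟩ := Set.Infinite.exists_subset_card_eq hinf (Z.card + 2)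
        have := key W (fun p hp => hW hp)
        omega
      refine ⟨hfin.toFinset, ?_, ?_⟩
      · have := key hfin.toFinset (by simp)
        rw [Finset.card_insert_of_notMem ha]; omega
      · intro p hp; simpa using (hz p).1 hp
    · push Not at hne
      refine ⟨∅, by simp, fun p hp => ?_⟩
      exfalso
      apply hg0
      rw [← (hz p).1 hp]
      exact is_const_of_deriv_eq_zero (fun q => (hd q).differentiableAt)
        (fun q => (hd q).deriv.trans (hne q)) _ _

def Rlz {m d : ℕ} (A : Fin m → Fin d → ℝ) (T : Finset (Fin m)) : Prop :=
  ∃ w : Fin d → ℝ, ∀ j, (j ∈ T → 0 < A j ⬝ᵥ w) ∧ (j ∉ T → A j ⬝ᵥ w < 0)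

open Classical in
theorem sauer {m d : ℕ} (A : Fin m → Fin d → ℝ) :
    (univ.filter (Rlz A)).card ≤ (m + 1) ^ d := by
  set F := univ.filter (Rlz A)
  have hvc : F.vcDim ≤ d := by
    refine Finset.sup_le fun S hS => ?_
    rw [Finset.mem_shatterer] at hS
    by_contra hlt
    push Not at hlt
    have hli : ¬ LinearIndependent ℝ (fun j : S => A j) := by
      intro h
      have := h.fintype_card_le_finrank
      simp at this; omega
    obtain ⟨g, hg, i, hi⟩ := Fintype.not_linearIndependent_iff.1 hli
    have : ∃ g : S → ℝ, ∑ j : S, g j • A j = 0 ∧ ∃ i, 0 < g i := by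
      rcases lt_or_gt_of_ne hi with h | h
      · exact ⟨-g, by simpa using hg, i, by simpa using h⟩
      · exact ⟨g, hg, i, h⟩
    clear hg hi
    obtain ⟨g, hg, i, hi⟩ := this
    obtain ⟨T, hT, hST⟩ := hS (t := S.attach.filter (fun j => g j ≤ 0) |>.map (Function.Embedding.subtype _)) (by
      intro x hx; simp at hx; exact hx.1)
    obtain ⟨w, hw⟩ := (Finset.mem_filter.1 hT).2
    have hmem : ∀ j : S, (j : Fin m) ∈ T ↔ g j ≤ 0 := by
      intro j
      have : (j : Fin m) ∈ S ∩ T ↔ g j ≤ 0 := by rw [hST]; simp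
      rw [← this]; simp
    have h0 : (∑ j : S, g j • A j) ⬝ᵥ w = 0 := by rw [hg]; simp
    rw [sum_dotProduct] at h0
    have : ∑ j : S, (g j • A j) ⬝ᵥ w < 0 := by
      refine Finset.sum_neg' (fun j _ => ?_) ⟨i, mem_univ _, ?_⟩
      · rw [smul_dotProduct, smul_eq_mul]
        rcases le_or_gt (g j) 0 with h | h
        · exact mul_nonpos_of_nonpos_of_nonneg h ((hw j).1 ((hmem j).2 h)).le
        · exact mul_nonpos_of_nonneg_of_nonpos h.le ((hw j).2 (fun h' => absurd ((hmem j).1 h') (not_le.2 h))).le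
      · rw [smul_dotProduct, smul_eq_mul]
        exact mul_neg_of_pos_of_neg hi ((hw i).2 (fun h' => absurd ((hmem i).1 h') (not_le.2 hi)))
    linarith
  calc F.card ≤ F.shatterer.card := Finset.card_le_card_shatterer _
    _ ≤ ∑ k ∈ Finset.Iic F.vcDim, (Fintype.card (Fin m)).choose k := Finset.card_shatterer_le_sum_vcDim
    _ ≤ ∑ k ∈ Finset.Iic d, (Fintype.card (Fin m)).choose k :=
      Finset.sum_le_sum_of_subset (Finset.Iic_subset_Iic.2 hvc)
    _ ≤ ∑ k ∈ Finset.range (d + 1), m ^ k * 1 ^ (d - k) * d.choose k := by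
      have : Finset.Iic d = Finset.range (d + 1) := by ext; simp
      rw [this]
      refine Finset.sum_le_sum fun k hk => ?_
      have hk : k ≤ d := by simp at hk; omega
      have h1 := Nat.choose_le_pow m k
      have h2 := Nat.choose_pos hk
      simp only [Fintype.card_fin, one_pow, mul_one]
      nlinarith [Nat.zero_le (m ^ k)]
    _ = (m + 1) ^ d := by rw [add_pow]; rfl
def extv {m d : ℕ} (A : Fin m → Fin d → ℝ) : Fin m ⊕ Fin d → Fin d → ℝ :=
  Sum.elim A (fun i => Pi.single i 1)

/-- The Gordan alternative with Caratheodory and completion to a basis. -/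
theorem gordan {m d : ℕ} (a : Fin m → Fin d → ℝ) (h : ¬ ∃ w, ∀ j, 0 < a j ⬝ᵥ w) :
    ∃ (t : Fin m) (s : Fin d → Fin m ⊕ Fin d) (c : Fin d → ℝ),
      LinearIndependent ℝ (fun k => extv a (s k)) ∧ a t = ∑ k, c k • extv a (s k) ∧
      (∀ k, c k ≤ 0) ∧ (∀ k i, s k = Sum.inr i → c k = 0) := by
  classical
  have h0 : (0 : Fin d → ℝ) ∈ convexHull ℝ (Set.range a) := by
    by_contra h0
    obtain ⟨f, r, hr, hf⟩ := geometric_hahn_banach_point_closed (convex_convexHull ℝ (Set.range a))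
      ((Set.finite_range a).isCompact_convexHull (𝕜 := ℝ)).isClosed h0
    apply h
    refine ⟨fun i => f (Pi.single i 1), fun j => ?_⟩
    have h1 := hf (a j) (subset_convexHull ℝ _ ⟨j, rfl⟩)
    have h2 : f (a j) = a j ⬝ᵥ (fun i => f (Pi.single i 1)) := by
      conv_lhs => rw [pi_eq_sum_univ' (a j)]
      rw [map_sum]
      simp only [dotProduct, map_smul, smul_eq_mul]
    rw [← h2]
    rw [map_zero] at hr
    linarith
  obtain ⟨ι, _, z, l, hz, hai, hl, hl1, hlz⟩ := eq_pos_convex_span_of_mem_convexHull h0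
  choose J hJ using fun x => hz ⟨x, rfl⟩
  have hne : Nonempty ι := by
    by_contra hne
    rw [not_nonempty_iff] at hne
    simp at hl1
  obtain ⟨t0⟩ := hne
  have haff := affineIndependent_iff.1 hai
  have key : ∀ c : ι → ℝ, c t0 = 0 → ∑ x, c x • z x = 0 → ∀ x, c x = 0 := by
    intro c h1 h2
    have h3 := haff univ (fun x => c x - (∑ y, c y) * l x)
      (by rw [Finset.sum_sub_distrib, ← Finset.mul_sum, hl1]; ring)
      (by simp only [sub_smul, mul_smul]; rw [Finset.sum_sub_distrib, ← Finset.smul_sum, hlz, h2]; simp)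
    have h4 := h3 t0 (mem_univ _)
    simp only [h1] at h4
    have h5 : ∑ y, c y = 0 := by
      have := hl t0
      rcases mul_eq_zero.1 (show (∑ y, c y) * l t0 = 0 by linarith) with h | h
      · exact h
      · linarith
    intro x
    have := h3 x (mem_univ _)
    simpa [h5] using this
  have hJinj : Function.Injective J := by
    intro x y hxy
    apply hai.injective
    rw [← hJ, ← hJ, hxy]
  let S : Set (Fin m ⊕ Fin d) := (fun x => Sum.inl (J x)) '' {x | x ≠ t0}
  have hinj' : Function.Injective (fun x => (Sum.inl (J x) : Fin m ⊕ Fin d)) :=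
    Sum.inl_injective.comp hJinj
  have hS : LinearIndepOn ℝ (extv a) S := by
    refine LinearIndepOn.image_of_comp (s := {x | x ≠ t0}) _ _ ?_
    have hcomp : (extv a ∘ fun x => Sum.inl (J x)) = z := by
      funext x; simp [extv, hJ]
    rw [hcomp]
    rw [LinearIndepOn, Fintype.linearIndependent_iff]
    intro g hg i
    have := key (fun x => if hx : x ≠ t0 then g ⟨x, hx⟩ else 0) (by simp) (by
      rw [← hg]
      symm
      refine Fintype.sum_of_injective Subtype.val Subtype.val_injective _ _ ?_ ?_
      · intro x hx
        have : x = t0 := by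
          by_contra hne
          exact hx ⟨⟨x, hne⟩, rfl⟩
        simp [this]
      · intro x
        have hx : (x : ι) ≠ t0 := x.2
        simp [hx]) i
    have hi : (i : ι) ≠ t0 := i.2
    simpa [hi] using this
  let B := hS.extend (Set.subset_univ S)
  have hB : LinearIndepOn ℝ (extv a) B := hS.linearIndepOn_extend _
  have hSB : S ⊆ B := hS.subset_extend _
  have hspan : Submodule.span ℝ (extv a '' B) = ⊤ := by
    rw [hS.span_image_extend_eq_span_image, eq_top_iff, ← (Pi.basisFun ℝ (Fin d)).span_eq]
    apply Submodule.span_mono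
    rintro _ ⟨i, rfl⟩
    exact ⟨Sum.inr i, trivial, by simp [extv]⟩
  let b : Module.Basis B ℝ (Fin d → ℝ) := Module.Basis.mk (v := fun x : B => extv a x) hB (by
    rw [← hspan, Set.image_eq_range])
  have hcard : Fintype.card B = d := by
    have := Module.finrank_eq_card_basis b
    simpa using this.symm
  let e : Fin d ≃ B := (Fintype.equivFinOfCardEq hcard).symm
  -- coefficients
  let cB : Fin m ⊕ Fin d → ℝ := fun y => ∑ x, if x ≠ t0 ∧ Sum.inl (J x) = y then - l x / l t0 else 0
  refine ⟨J t0, fun k => e k, fun k => cB (e k), hB.comp e e.injective, ?_, ?_, ?_⟩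
  · rw [e.sum_comp (fun y : B => cB y • extv a y)]
    have h1 : ∀ y : B, cB y • extv a y = ∑ x, if x ≠ t0 ∧ Sum.inl (J x) = (y : Fin m ⊕ Fin d) then (- l x / l t0) • z x else 0 := by
      intro y
      simp only [cB]
      rw [Finset.sum_smul]
      refine Finset.sum_congr rfl fun x _ => ?_
      split_ifs with hx
      · rw [← hx.2]; simp [extv, hJ]
      · simp
    simp_rw [h1]
    rw [Finset.sum_comm]
    have h2 : ∀ x, (∑ y : B, if x ≠ t0 ∧ Sum.inl (J x) = (y : Fin m ⊕ Fin d) then (- l x / l t0) • z x else 0)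
        = if x ≠ t0 then (- l x / l t0) • z x else 0 := by
      intro x
      by_cases hx : x ≠ t0
      · have hm : (Sum.inl (J x) : Fin m ⊕ Fin d) ∈ B := hSB ⟨x, hx, rfl⟩
        rw [Finset.sum_eq_single ⟨_, hm⟩]
        · simp [hx]
        · intro y _ hy
          rw [if_neg]
          rintro ⟨_, h⟩
          exact hy (Subtype.ext h.symm)
        · simp
      · simp [hx]
    simp_rw [h2]
    have h3 : ∑ x, (if x ≠ t0 then (- l x / l t0) • z x else 0) = ∑ x, (- l x / l t0) • z x + z t0 := by
      rw [← Finset.add_sum_erase _ _ (mem_univ t0), ← Finset.add_sum_erase univ (fun x => (- l x / l t0) • z x) (mem_univ t0)]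
      have h4 : ∑ x ∈ univ.erase t0, (if x ≠ t0 then (- l x / l t0) • z x else 0) = ∑ x ∈ univ.erase t0, (- l x / l t0) • z x :=
        Finset.sum_congr rfl fun x hx => if_pos (Finset.ne_of_mem_erase hx)
      rw [h4]
      have := (hl t0).ne'
      rw [neg_div, div_self this]
      simp
    rw [h3, hJ]
    have h5 : ∑ x, (- l x / l t0) • z x = (-1 / l t0) • ∑ x, l x • z x := by
      rw [Finset.smul_sum]
      refine Finset.sum_congr rfl fun x _ => ?_
      rw [smul_smul]; congr 1; ring
    rw [h5, hlz]; simp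
  · intro k
    refine Finset.sum_nonpos fun x _ => ?_
    split_ifs
    · have := hl x
      have := hl t0
      rw [neg_div]
      have : 0 < l x / l t0 := by positivity
      linarith
    · exact le_rfl
  · intro k i hk
    refine Finset.sum_eq_zero fun x _ => if_neg ?_
    rintro ⟨_, h⟩
    exact absurd (h.trans hk) (by simp)

theorem chi_core {m d : ℕ} (a a' : Fin m → Fin d → ℝ)
    (h : ∀ s : Fin d → Fin m ⊕ Fin d, SignType.sign (Matrix.of fun k => extv a (s k)).det
      = SignType.sign (Matrix.of fun k => extv a' (s k)).det)
    (hw : ∃ w, ∀ j, 0 < a j ⬝ᵥ w) : ∃ w, ∀ j, 0 < a' j ⬝ᵥ w := by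
  classical
  by_contra hcon
  obtain ⟨t, s, c, hli, hsum, hc, hc0⟩ := gordan a' hcon
  obtain ⟨w, hw⟩ := hw
  set M' : Matrix (Fin d) (Fin d) ℝ := Matrix.of fun k => extv a' (s k) with hM'
  set M : Matrix (Fin d) (Fin d) ℝ := Matrix.of fun k => extv a (s k) with hM
  have hdet' : M'.det ≠ 0 := by
    have : IsUnit M' := Matrix.linearIndependent_rows_iff_isUnit.1 hli
    exact ((Matrix.isUnit_iff_isUnit_det _).1 this).ne_zero
  have hdet : M.det ≠ 0 := by
    rw [← sign_ne_zero (a := M.det), h s, sign_ne_zero]; exact hdet'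
  have hup : ∀ (x : Fin m → Fin d → ℝ) k, (Matrix.of fun l => extv x (Function.update s k (Sum.inl t) l))
      = (Matrix.of fun l => extv x (s l)).updateRow k (x t) := by
    intro x k
    ext l i
    by_cases hl : l = k
    · subst hl; simp [extv]
    · simp [hl]
  have hk' : ∀ k, (M'.updateRow k (a' t)).det = c k * M'.det := by
    intro k
    rw [hsum]
    exact Matrix.det_updateRow_sum M' k c
  have hsg : ∀ k, SignType.sign (M.updateRow k (a t)).det = SignType.sign (c k) * SignType.sign M.det := by
    intro k
    rw [hM, ← hup, h, hup, h, ← hM', hk', sign_mul]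
  let g : Fin d → ℝ := fun k => (M.updateRow k (a t)).det / M.det
  have hg : ∀ k, (M.updateRow k (a t)).det = g k * M.det := fun k => by simp only [g]; field_simp
  have hgs : ∀ k, SignType.sign (g k) = SignType.sign (c k) := by
    intro k
    have := hsg k
    rw [hg, sign_mul] at this
    have h0 : SignType.sign M.det ≠ 0 := sign_ne_zero.2 hdet
    exact mul_right_cancel₀ h0 this
  have hcr : M.det • a t = ∑ k, (M.updateRow k (a t)).det • M k := by
    rw [← Matrix.det_transpose M, ← Matrix.mulVec_cramer, Matrix.mulVec_transpose, Matrix.vecMul_eq_sum]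
    simp_rw [Matrix.cramer_transpose_apply]
  have hat : a t = ∑ k, g k • extv a (s k) := by
    have h1 : M.det • a t = M.det • ∑ k, g k • extv a (s k) := by
      rw [hcr, Finset.smul_sum]
      refine Finset.sum_congr rfl fun k _ => ?_
      rw [hg, smul_smul, mul_comm]; rfl
    exact smul_right_injective _ hdet h1
  have h1 := hw t
  rw [hat, sum_dotProduct] at h1
  have h2 : ∑ k, (g k • extv a (s k)) ⬝ᵥ w ≤ 0 := by
    refine Finset.sum_nonpos fun k _ => ?_
    rw [smul_dotProduct, smul_eq_mul]
    rcases hs : s k with j | i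
    · refine mul_nonpos_of_nonpos_of_nonneg ?_ (hw j).le
      have := hc k
      rw [← sign_nonpos_iff, hgs, sign_nonpos_iff]; exact this
    · have : g k = 0 := by
        rw [← sign_eq_zero_iff, hgs, sign_eq_zero_iff]; exact hc0 k i hs
      simp [this]
  linarith

theorem chi {m d : ℕ} (A A' : Fin m → Fin d → ℝ)
    (h : ∀ s : Fin d → Fin m ⊕ Fin d, SignType.sign (Matrix.of fun k => extv A (s k)).det
      = SignType.sign (Matrix.of fun k => extv A' (s k)).det) (T : Finset (Fin m))
    (hT : Rlz A T) : Rlz A' T := by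
  classical
  let ε : Fin m → ℝ := fun j => if j ∈ T then 1 else -1
  let ε' : Fin m ⊕ Fin d → ℝ := Sum.elim ε (fun _ => 1)
  have hiff : ∀ (x : Fin m → Fin d → ℝ) (w : Fin d → ℝ) (j : Fin m), 0 < (ε j • x j) ⬝ᵥ w ↔
      ((j ∈ T → 0 < x j ⬝ᵥ w) ∧ (j ∉ T → x j ⬝ᵥ w < 0)) := by
    intro x w j
    rw [smul_dotProduct, smul_eq_mul]
    by_cases hj : j ∈ T <;> simp [ε, hj]
  have hd : ∀ (x : Fin m → Fin d → ℝ) (s : Fin d → Fin m ⊕ Fin d),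
      (Matrix.of fun k => extv (fun j => ε j • x j) (s k)).det
        = (∏ k, ε' (s k)) * (Matrix.of fun k => extv x (s k)).det := by
    intro x s
    rw [← Matrix.det_mul_column]
    congr 1
    ext k i
    rcases hs : s k with j | i <;> simp [extv, hs, ε']
  obtain ⟨w, hw⟩ := chi_core (fun j => ε j • A j) (fun j => ε j • A' j) (by
    intro s
    rw [hd, hd, sign_mul, sign_mul, h]) (by
    obtain ⟨w, hw⟩ := hT
    exact ⟨w, fun j => (hiff A w j).2 (hw j)⟩)
  exact ⟨w, fun j => (hiff A' w j).1 (hw j)⟩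

noncomputable def Amat {m d : ℕ} (lu lv : Fin m → Fin d → ℝ) (p : ℝ) : Fin m → Fin d → ℝ :=
  fun j i => Real.exp (lu j i * p) - Real.exp (lv j i * p)

noncomputable def Dfun {m d : ℕ} (lu lv : Fin m → Fin d → ℝ) (s : Fin d → Fin m ⊕ Fin d) (p : ℝ) : ℝ :=
  (Matrix.of fun k => extv (Amat lu lv p) (s k)).det

def coefA {m d : ℕ} : Fin m ⊕ Fin d → Fin d → Bool → ℝ
  | Sum.inl _, _, true => 1
  | Sum.inl _, _, false => -1
  | Sum.inr j, i, true => if i = j then 1 else 0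
  | Sum.inr _, _, false => 0

def coefL {m d : ℕ} (lu lv : Fin m → Fin d → ℝ) : Fin m ⊕ Fin d → Fin d → Bool → ℝ
  | Sum.inl j, i, true => lu j i
  | Sum.inl j, i, false => lv j i
  | Sum.inr _, _, _ => 0

theorem Dfun_eq {m d : ℕ} (lu lv : Fin m → Fin d → ℝ) (s : Fin d → Fin m ⊕ Fin d) (p : ℝ) :
    Dfun lu lv s p = ∑ x : Equiv.Perm (Fin d) × (Fin d → Bool),
      (((Equiv.Perm.sign x.1 : ℤ) : ℝ) * ∏ i, coefA (s (x.1 i)) i (x.2 i)) *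
        Real.exp ((∑ i, coefL lu lv (s (x.1 i)) i (x.2 i)) * p) := by
  have hent : ∀ r i, extv (Amat lu lv p) r i =
      ∑ k : Bool, coefA r i k * Real.exp (coefL lu lv r i k * p) := by
    intro r i
    rcases r with j | j
    · simp [extv, Amat, coefA, coefL]; ring
    · simp [extv, coefA, coefL, Pi.single_apply]
  rw [Dfun, Matrix.det_apply', Fintype.sum_prod_type]
  refine Finset.sum_congr rfl fun σ _ => ?_
  simp only [Matrix.of_apply, hent]
  rw [Finset.prod_univ_sum, Fintype.piFinset_univ, Finset.mul_sum]
  refine Finset.sum_congr rfl fun κ _ => ?_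
  rw [Finset.prod_mul_distrib, ← Real.exp_sum, Finset.sum_mul]
  ring

theorem Dfun_zeros {m d : ℕ} (lu lv : Fin m → Fin d → ℝ) (s : Fin d → Fin m ⊕ Fin d) :
    ∃ Z : Finset ℝ, Z.card + 1 ≤ d.factorial * 2 ^ d ∧
      ((∀ p, Dfun lu lv s p = 0) ∨ ∀ p, Dfun lu lv s p = 0 → p ∈ Z) := by
  classical
  by_cases h : ∀ p, Dfun lu lv s p = 0
  · refine ⟨∅, ?_, Or.inl h⟩
    have := Nat.factorial_pos d
    have : 0 < 2 ^ d := by positivity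
    simp only [card_empty, zero_add]
    exact Nat.succ_le_of_lt (by positivity)
  · push Not at h
    obtain ⟨p, hp⟩ := h
    simp only [Dfun_eq] at hp ⊢
    obtain ⟨Z, hZ1, hZ2⟩ := expsum_zeros univ _ _ ⟨p, hp⟩
    refine ⟨Z, ?_, Or.inr hZ2⟩
    simpa [Fintype.card_perm] using hZ1

theorem Dfun_cont {m d : ℕ} (lu lv : Fin m → Fin d → ℝ) (s : Fin d → Fin m ⊕ Fin d) :
    Continuous (Dfun lu lv s) := by
  have : Dfun lu lv s = _ := funext (Dfun_eq lu lv s)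
  rw [this]
  fun_prop

theorem sign_const (f : ℝ → ℝ) (hf : Continuous f) (p q : ℝ) (hpq : p ≤ q)
    (h : ∀ x ∈ Set.Icc p q, f x ≠ 0) : SignType.sign (f p) = SignType.sign (f q) := by
  have hp := h p ⟨le_rfl, hpq⟩
  have hq := h q ⟨hpq, le_rfl⟩
  rcases lt_or_gt_of_ne hp with h1 | h1 <;> rcases lt_or_gt_of_ne hq with h2 | h2
  · rw [sign_neg h1, sign_neg h2]
  · obtain ⟨x, hx, hx0⟩ := intermediate_value_Icc hpq hf.continuousOn ⟨h1.le, h2.le⟩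
    exact absurd hx0 (h x hx)
  · obtain ⟨x, hx, hx0⟩ := intermediate_value_Icc' hpq hf.continuousOn ⟨h2.le, h1.le⟩
    exact absurd hx0 (h x hx)
  · rw [sign_pos h1, sign_pos h2]

theorem code_no_mem (Z : Finset ℝ) (p q : ℝ) (hpq : p < q)
    (h : (Z.filter (· < p)).card + (Z.filter (· ≤ p)).card
      = (Z.filter (· < q)).card + (Z.filter (· ≤ q)).card) : ∀ x ∈ Set.Icc p q, x ∉ Z := by
  intro x hx hxZ
  have s1 : Z.filter (· < p) ⊆ Z.filter (· < q) :=
    Finset.monotone_filter_right _ fun y _ hy => lt_trans hy hpq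
  have s2 : Z.filter (· ≤ p) ⊆ Z.filter (· ≤ q) :=
    Finset.monotone_filter_right _ fun y _ hy => le_trans hy hpq.le
  have c1 := Finset.card_le_card s1
  have c2 := Finset.card_le_card s2
  have e1 := Finset.eq_of_subset_of_card_le s1 (by omega)
  have e2 := Finset.eq_of_subset_of_card_le s2 (by omega)
  rcases lt_or_eq_of_le hx.2 with hlt | heq
  · have : x ∈ Z.filter (· < p) := by rw [e1]; simp [hxZ, hlt]
    simp at this
    linarith [hx.1]
  · have : x ∈ Z.filter (· ≤ p) := by rw [e2]; simp [hxZ, hx.2]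
    simp at this
    linarith

theorem count_main {m d : ℕ} (B lu lv : Fin m → Fin d → ℝ)
    (h : ∀ T, Rlz B T ∨ ∃ p, Rlz (Amat lu lv p) T) :
    2 ^ m ≤ 2 * ((m + d) ^ d * (d.factorial * 2 ^ d)) * (m + 1) ^ d := by
  classical
  choose Z hZc hZ using Dfun_zeros lu lv
  let ZZ : Finset ℝ := univ.biUnion Z
  have hZZ : ZZ.card + (m + d) ^ d ≤ (m + d) ^ d * (d.factorial * 2 ^ d) := by
    have h1 : ZZ.card ≤ ∑ s, (Z s).card := Finset.card_biUnion_le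
    have h2 : ∑ s : Fin d → Fin m ⊕ Fin d, ((Z s).card + 1) ≤
        ∑ s : Fin d → Fin m ⊕ Fin d, (d.factorial * 2 ^ d) := Finset.sum_le_sum fun s _ => hZc s
    rw [Finset.sum_add_distrib] at h2
    simp at h2
    omega
  let code : ℝ → ℕ := fun p => (ZZ.filter (· < p)).card + (ZZ.filter (· ≤ p)).card
  have hcode : ∀ p, code p < 2 * ZZ.card + 1 := by
    intro p
    have h1 := Finset.card_filter_le ZZ (· < p)
    have h2 := Finset.card_filter_le ZZ (· ≤ p)
    simp only [code]; omega
  have hlt : ∀ p q, p < q → code p = code q → ∀ s, SignType.sign (Dfun lu lv s p)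
      = SignType.sign (Dfun lu lv s q) := by
    intro p q hpq hc s
    rcases hZ s with h0 | h0
    · rw [h0, h0]
    · refine sign_const _ (Dfun_cont lu lv s) p q hpq.le fun x hx hx0 => ?_
      exact code_no_mem ZZ p q hpq hc x hx (Finset.mem_biUnion.2 ⟨s, mem_univ _, h0 x hx0⟩)
  have hsame : ∀ p q, code p = code q → ∀ s, SignType.sign (Dfun lu lv s p)
      = SignType.sign (Dfun lu lv s q) := by
    intro p q hc s
    rcases lt_trichotomy p q with h1 | h1 | h1
    · exact hlt p q h1 hc s
    · rw [h1]
    · exact (hlt q p h1 hc.symm s).symm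
  let F : ℕ → Finset (Finset (Fin m)) := fun c => univ.filter fun T => ∃ p, code p = c ∧ Rlz (Amat lu lv p) T
  have hF : ∀ c, (F c).card ≤ (m + 1) ^ d := by
    intro c
    by_cases hc : ∃ p, code p = c
    · obtain ⟨p, hp⟩ := hc
      refine le_trans (Finset.card_le_card ?_) (sauer (Amat lu lv p))
      intro T hT
      obtain ⟨q, hq, hr⟩ := (Finset.mem_filter.1 hT).2
      exact Finset.mem_filter.2 ⟨mem_univ _, chi _ _ (fun s => hsame q p (hq.trans hp.symm) s) T hr⟩
    · have : F c = ∅ := by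
        refine Finset.filter_eq_empty_iff.2 fun T _ => ?_
        rintro ⟨p, hp, _⟩
        exact hc ⟨p, hp⟩
      rw [this]; simp
  have hcov : (univ : Finset (Finset (Fin m))) ⊆
      univ.filter (Rlz B) ∪ (range (2 * ZZ.card + 1)).biUnion F := by
    intro T _
    rcases h T with hT | ⟨p, hp⟩
    · exact Finset.mem_union_left _ (Finset.mem_filter.2 ⟨mem_univ _, hT⟩)
    · refine Finset.mem_union_right _ (Finset.mem_biUnion.2 ⟨code p, ?_, ?_⟩)
      · exact Finset.mem_range.2 (hcode p)
      · exact Finset.mem_filter.2 ⟨mem_univ _, p, rfl, hp⟩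
  have h1 : 2 ^ m ≤ (m + 1) ^ d + (2 * ZZ.card + 1) * (m + 1) ^ d := by
    calc 2 ^ m = (univ : Finset (Finset (Fin m))).card := by simp
      _ ≤ _ := Finset.card_le_card hcov
      _ ≤ (univ.filter (Rlz B)).card + ((range (2 * ZZ.card + 1)).biUnion F).card :=
        Finset.card_union_le _ _
      _ ≤ (m + 1) ^ d + (2 * ZZ.card + 1) * (m + 1) ^ d := by
        refine add_le_add (sauer B) ?_
        have := Finset.card_biUnion_le_card_mul (range (2 * ZZ.card + 1)) F _ (fun c _ => hF c)
        simpa using this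
  have h2 : 1 ≤ (m + d) ^ d := by
    rcases Nat.eq_zero_or_pos d with h | h
    · simp [h]
    · exact Nat.one_le_pow _ _ (by omega)
  calc 2 ^ m ≤ _ := h1
    _ = (2 * ZZ.card + 2) * (m + 1) ^ d := by ring
    _ ≤ _ := Nat.mul_le_mul_right _ (by omega)

theorem numeric (d : ℕ) (hd : 2 ≤ d) (L : ℕ) (h1 : d ^ d ≤ 2 ^ L) (h2 : 2 ^ L < 2 * d ^ d) :
    2 * ((8 * (L + 1) + d) ^ d * (d.factorial * 2 ^ d)) * (8 * (L + 1) + 1) ^ d < 2 ^ (8 * (L + 1)) := by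
  rcases (show d = 2 ∨ d = 3 ∨ d = 4 ∨ d = 5 ∨ 6 ≤ d by omega) with rfl | rfl | rfl | rfl | h5
  · have : L < 3 := (Nat.pow_lt_pow_iff_right (a := 2) (by norm_num)).1 (lt_of_lt_of_le h2 (by norm_num))
    have : 1 < L := (Nat.pow_lt_pow_iff_right (a := 2) (by norm_num)).1 (lt_of_lt_of_le (by norm_num) h1)
    obtain rfl : L = 2 := by omega
    norm_num [Nat.factorial]
  · have : L < 6 := (Nat.pow_lt_pow_iff_right (a := 2) (by norm_num)).1 (lt_of_lt_of_le h2 (by norm_num))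
    have : 4 < L := (Nat.pow_lt_pow_iff_right (a := 2) (by norm_num)).1 (lt_of_lt_of_le (by norm_num) h1)
    obtain rfl : L = 5 := by omega
    norm_num [Nat.factorial]
  · have : L < 9 := (Nat.pow_lt_pow_iff_right (a := 2) (by norm_num)).1 (lt_of_lt_of_le h2 (by norm_num))
    have : 7 < L := (Nat.pow_lt_pow_iff_right (a := 2) (by norm_num)).1 (lt_of_lt_of_le (by norm_num) h1)
    obtain rfl : L = 8 := by omega
    norm_num [Nat.factorial]
  · have : L < 13 := (Nat.pow_lt_pow_iff_right (a := 2) (by norm_num)).1 (lt_of_lt_of_le h2 (by norm_num))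
    have : 11 < L := (Nat.pow_lt_pow_iff_right (a := 2) (by norm_num)).1 (lt_of_lt_of_le (by norm_num) h1)
    obtain rfl : L = 12 := by omega
    norm_num [Nat.factorial]
  · have hL : L ≤ (d - 1) * d := by
      have h3 : d ≤ 2 ^ (d - 1) := by
        have := Nat.lt_two_pow_self (n := d - 1)
        omega
      have h4 : 2 ^ L < 2 ^ (1 + (d - 1) * d) := by
        refine lt_of_lt_of_le h2 ?_
        rw [pow_add, pow_mul, pow_one]
        exact Nat.mul_le_mul_left _ (Nat.pow_le_pow_left h3 d)
      have := (Nat.pow_lt_pow_iff_right (a := 2) (by norm_num)).1 h4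
      omega
    set m := 8 * (L + 1) with hm
    have hmd : m ≤ 8 * ((d - 1) * d + 1) := by omega
    have hdd : (d - 1) * d + d = d ^ 2 := by
      obtain ⟨e, rfl⟩ : ∃ e, d = e + 1 := ⟨d - 1, by omega⟩
      simp; ring
    have hk : (m + d) * d * 2 * (m + 1) ≤ d ^ 8 := by
      have a1 : m + d ≤ 8 * d ^ 2 := by omega
      have a2 : m + 1 ≤ 8 * d ^ 2 := by omega
      have a3 : 128 ≤ d ^ 3 := by
        calc 128 ≤ 6 ^ 3 := by norm_num
          _ ≤ d ^ 3 := Nat.pow_le_pow_left (by omega) 3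
      calc (m + d) * d * 2 * (m + 1) ≤ (8 * d ^ 2) * d * 2 * (8 * d ^ 2) := by gcongr
        _ = 128 * d ^ 5 := by ring
        _ ≤ d ^ 3 * d ^ 5 := by gcongr
        _ = d ^ 8 := by ring
    calc 2 * ((m + d) ^ d * (d.factorial * 2 ^ d)) * (m + 1) ^ d
        ≤ 2 * ((m + d) ^ d * (d ^ d * 2 ^ d)) * (m + 1) ^ d := by
          gcongr; exact Nat.factorial_le_pow d
      _ = 2 * ((m + d) * d * 2 * (m + 1)) ^ d := by simp only [mul_pow]; ac_rfl
      _ ≤ 2 * (d ^ 8) ^ d := by gcongr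
      _ = 2 * (d ^ d) ^ 8 := by rw [← pow_mul, ← pow_mul, Nat.mul_comm 8 d]
      _ ≤ 2 * (2 ^ L) ^ 8 := by gcongr
      _ < 2 ^ 8 * (2 ^ L) ^ 8 := by
          have : 0 < (2 ^ L) ^ 8 := by positivity
          omega
      _ = 2 ^ m := by rw [hm, ← pow_mul, ← pow_add]; congr 1; ring

theorem logb_bounds (d : ℕ) (hd : 2 ≤ d) :
    d ^ d ≤ 2 ^ ⌈(d : ℝ) * Real.logb 2 d⌉₊ ∧ 2 ^ ⌈(d : ℝ) * Real.logb 2 d⌉₊ < 2 * d ^ d := by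
  have hd0 : (0 : ℝ) < d := by positivity
  have hx : (2 : ℝ) ^ ((d : ℝ) * Real.logb 2 d) = (d : ℝ) ^ d := by
    rw [mul_comm, Real.rpow_mul (by norm_num), Real.rpow_logb (by norm_num) (by norm_num) hd0,
      Real.rpow_natCast]
  have hx0 : 0 ≤ (d : ℝ) * Real.logb 2 d :=
    mul_nonneg hd0.le (Real.logb_nonneg (by norm_num) (by exact_mod_cast (by omega : 1 ≤ d)))
  constructor
  · have : (d : ℝ) ^ d ≤ (2 : ℝ) ^ ((⌈(d : ℝ) * Real.logb 2 d⌉₊ : ℕ) : ℝ) := by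
      rw [← hx]
      exact Real.rpow_le_rpow_of_exponent_le (by norm_num) (Nat.le_ceil _)
    rw [Real.rpow_natCast] at this
    exact_mod_cast this
  · have : (2 : ℝ) ^ ((⌈(d : ℝ) * Real.logb 2 d⌉₊ : ℕ) : ℝ) < 2 * (d : ℝ) ^ d := by
      rw [← hx]
      calc _ < (2 : ℝ) ^ ((d : ℝ) * Real.logb 2 d + 1) :=
            Real.rpow_lt_rpow_of_exponent_lt (by norm_num) (Nat.ceil_lt_add_one hx0)
        _ = _ := by rw [Real.rpow_add (by norm_num), Real.rpow_one, mul_comm]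
    rw [Real.rpow_natCast] at this
    exact_mod_cast this

/-- A strict comparison with a margin yields a strict linear sign condition. -/
theorem realize {m d : ℕ} (u v : Fin m → Fin d → ℝ) (hu : ∀ j i, 0 < u j i) (hv : ∀ j i, 0 < v j i)
    (δ : ℝ) (T : Finset (Fin m)) (w : Fin d → ℝ) (p : ℝ) (hw : inSimplex w)
    (h1 : ∀ j ∈ T, 0 < Real.log (pmean (u j) w p) - Real.log (pmean (v j) w p) + δ)
    (h2 : ∀ j ∉ T, Real.log (pmean (u j) w p) - Real.log (pmean (v j) w p) + δ < 0) :
    Rlz (fun j i => (Real.log (u j i) + δ) - Real.log (v j i)) T ∨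
    ∃ p, Rlz (Amat (fun j i => Real.log (u j i) + δ) (fun j i => Real.log (v j i)) p) T := by
  obtain ⟨hw0, hw1⟩ := hw
  by_cases hp : p = 0
  · left
    refine ⟨w, fun j => ?_⟩
    have hlog : ∀ x : Fin d → ℝ, (∀ i, 0 < x i) → Real.log (pmean x w p) = ∑ i, w i * Real.log (x i) := by
      intro x hx
      rw [pmean, if_pos hp, Real.log_prod (fun i _ => (Real.rpow_pos_of_pos (hx i) _).ne')]
      exact Finset.sum_congr rfl fun i _ => Real.log_rpow (hx i) _
    have key : (fun i => (Real.log (u j i) + δ) - Real.log (v j i)) ⬝ᵥ w =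
        Real.log (pmean (u j) w p) - Real.log (pmean (v j) w p) + δ := by
      rw [hlog _ (hu j), hlog _ (hv j)]
      have : δ = ∑ i, w i * δ := by rw [← Finset.sum_mul, hw1, one_mul]
      conv_rhs => rw [this]
      rw [← Finset.sum_sub_distrib, ← Finset.sum_add_distrib, dotProduct]
      exact Finset.sum_congr rfl fun i _ => by ring
    simp only [key]
    exact ⟨h1 j, h2 j⟩
  · right
    refine ⟨p, ?_⟩
    have hpos : ∀ x : Fin d → ℝ, (∀ i, 0 < x i) → 0 < ∑ i, w i * x i ^ p := by
      intro x hx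
      have hnn : ∀ i ∈ univ, 0 ≤ w i * x i ^ p := fun i _ =>
        mul_nonneg (hw0 i) (Real.rpow_nonneg (hx i).le _)
      refine Finset.sum_pos' hnn ?_
      by_contra hcon
      push Not at hcon
      have : ∑ i, w i = 0 := Finset.sum_eq_zero fun i hi => by
        have h3 := hcon i hi
        have h4 := Real.rpow_pos_of_pos (hx i) p
        have h5 := hw0 i
        nlinarith
      linarith
    have hlog : ∀ x : Fin d → ℝ, (∀ i, 0 < x i) →
        Real.log (pmean x w p) = 1 / p * Real.log (∑ i, w i * x i ^ p) := by
      intro x hx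
      rw [pmean, if_neg hp, Real.log_rpow (hpos x hx)]
    have key : ∀ j, Amat (fun j i => Real.log (u j i) + δ) (fun j i => Real.log (v j i)) p j ⬝ᵥ w =
        Real.exp (δ * p) * (∑ i, w i * u j i ^ p) - ∑ i, w i * v j i ^ p := by
      intro j
      rw [Finset.mul_sum, ← Finset.sum_sub_distrib, dotProduct]
      refine Finset.sum_congr rfl fun i _ => ?_
      rw [Amat, Real.rpow_def_of_pos (hu j i), Real.rpow_def_of_pos (hv j i), add_mul, Real.exp_add]
      ring
    have key2 : ∀ j, p * (Real.log (pmean (u j) w p) - Real.log (pmean (v j) w p) + δ) =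
        Real.log (Real.exp (δ * p) * (∑ i, w i * u j i ^ p)) - Real.log (∑ i, w i * v j i ^ p) := by
      intro j
      rw [hlog _ (hu j), hlog _ (hv j), Real.log_mul (Real.exp_ne_zero _) (hpos _ (hu j)).ne',
        Real.log_exp]
      field_simp
      ring
    have hP : ∀ j, 0 < Real.exp (δ * p) * (∑ i, w i * u j i ^ p) := fun j =>
      mul_pos (Real.exp_pos _) (hpos _ (hu j))
    have hQ : ∀ j, 0 < ∑ i, w i * v j i ^ p := fun j => hpos _ (hv j)
    have hgt : ∀ j, 0 < p * (Real.log (pmean (u j) w p) - Real.log (pmean (v j) w p) + δ) →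
        0 < Amat (fun j i => Real.log (u j i) + δ) (fun j i => Real.log (v j i)) p j ⬝ᵥ w := by
      intro j h
      rw [key2] at h
      rw [key]
      have := (Real.log_lt_log_iff (hQ j) (hP j)).1 (by linarith)
      linarith
    have hlt : ∀ j, p * (Real.log (pmean (u j) w p) - Real.log (pmean (v j) w p) + δ) < 0 →
        Amat (fun j i => Real.log (u j i) + δ) (fun j i => Real.log (v j i)) p j ⬝ᵥ w < 0 := by
      intro j h
      rw [key2] at h
      rw [key]
      have := (Real.log_lt_log_iff (hP j) (hQ j)).1 (by linarith)
      linarith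
    rcases lt_or_gt_of_ne hp with hneg | hposp
    · refine ⟨-w, fun j => ⟨fun hj => ?_, fun hj => ?_⟩⟩
      · rw [dotProduct_neg]
        have := hlt j (mul_neg_of_neg_of_pos hneg (h1 j hj))
        linarith
      · rw [dotProduct_neg]
        have := hgt j (mul_pos_of_neg_of_neg hneg (h2 j hj))
        linarith
    · exact ⟨w, fun j => ⟨fun hj => hgt j (mul_pos hposp (h1 j hj)),
        fun hj => hlt j (mul_neg_of_pos_of_neg hposp (h2 j hj))⟩⟩

/-- No sequence of `m = 8(⌈d·log₂ d⌉ + 1)` pairs of positive vectors is shattered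
by the comparison class `{(u,v) ↦ C((u,v); w, p) : w ∈ Δ_{d-1}, p ∈ ℝ}`; hence
its VC dimension is less than `8(d log₂ d + 1)`. -/
theorem vc_comparison_unknown_weights (d : ℕ) (hd : 2 ≤ d) :
    ∀ u v : Fin (8 * (⌈(d : ℝ) * Real.logb 2 d⌉₊ + 1)) → Fin d → ℝ,
      (∀ j i, 0 < u j i) → (∀ j i, 0 < v j i) →
      ∃ b : Fin (8 * (⌈(d : ℝ) * Real.logb 2 d⌉₊ + 1)) → ℝ,
        (∀ j, b j = 1 ∨ b j = -1) ∧
        ¬ ∃ (w : Fin d → ℝ) (p : ℝ), inSimplex w ∧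
            ∀ j, pcmp (u j) (v j) w p = b j := by
  classical
  obtain ⟨hb1, hb2⟩ := logb_bounds d hd
  have hnum := numeric d hd _ hb1 hb2
  generalize 8 * (⌈(d : ℝ) * Real.logb 2 d⌉₊ + 1) = m at hnum ⊢
  intro u v hu hv
  by_contra hcon
  push Not at hcon
  have hT : ∀ T : Finset (Fin m), ∃ (w : Fin d → ℝ) (p : ℝ), inSimplex w ∧
      ∀ j, pcmp (u j) (v j) w p = if j ∈ T then 1 else -1 := fun T =>
    hcon (fun j => if j ∈ T then 1 else -1) (fun j => by by_cases hj : j ∈ T <;> simp [hj])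
  choose w p hw hpc using hT
  have hδ : ∃ δ : ℝ, 0 < δ ∧ ∀ x : Finset (Fin m) × Fin m,
      Real.log (pmean (u x.2) (w x.1) (p x.1)) - Real.log (pmean (v x.2) (w x.1) (p x.1)) < 0 →
      Real.log (pmean (u x.2) (w x.1) (p x.1)) - Real.log (pmean (v x.2) (w x.1) (p x.1)) + δ < 0 := by
    have hev : ∀ᶠ δ : ℝ in nhdsWithin 0 (Set.Ioi 0), ∀ x : Finset (Fin m) × Fin m,
        Real.log (pmean (u x.2) (w x.1) (p x.1)) - Real.log (pmean (v x.2) (w x.1) (p x.1)) < 0 →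
        Real.log (pmean (u x.2) (w x.1) (p x.1)) - Real.log (pmean (v x.2) (w x.1) (p x.1)) + δ < 0 := by
      rw [Filter.eventually_all]
      intro x
      by_cases hx : Real.log (pmean (u x.2) (w x.1) (p x.1)) - Real.log (pmean (v x.2) (w x.1) (p x.1)) < 0
      · have h3 : ∀ᶠ δ : ℝ in nhds 0, δ < -(Real.log (pmean (u x.2) (w x.1) (p x.1)) - Real.log (pmean (v x.2) (w x.1) (p x.1))) :=
          eventually_lt_nhds (by linarith)
        filter_upwards [nhdsWithin_le_nhds h3] with δ hδ _
        linarith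
      · exact Filter.Eventually.of_forall fun δ h => absurd h hx
    obtain ⟨δ, h1, h2⟩ := (hev.and self_mem_nhdsWithin).exists
    exact ⟨δ, h2, h1⟩
  obtain ⟨δ, hδ0, hδ⟩ := hδ
  refine absurd (count_main _ _ _ fun T => realize u v hu hv δ T (w T) (p T) (hw T) ?_ ?_) (not_le.2 hnum)
  · intro j hj
    have := hpc T j
    rw [if_pos hj, pcmp, sgn] at this
    split_ifs at this with h0
    · linarith
    · norm_num at this
  · intro j hj
    refine hδ (T, j) ?_
    have := hpc T j
    rw [if_neg hj, pcmp, sgn] at this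
    split_ifs at this with h0
    · norm_num at this
    · simpa using h0
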